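/- Let $(X,\mu)$ be a probability space, $T_1,T_2$ commuting invertible measure-preserving transformations, and suppose $\xi_1,\xi_2$ are sub-$\sigma$-algebras such that: (a) each $\xi_i$ contains the $\sigma$-algebra $\mathcal{I}$ of $T_1T_2^{-1}$-invariant sets; and (b) in the relatively independent self-joining $\mu^{\mathrm{F}} = \mu\otimes_{\mathcal{I}}\mu$, every $(T_1\times T_2)$-invariant function on $X\times X$ is measurable (up to null sets) with respect to $\xi_1\otimes\xi_2$. Then the pair $(\xi_1,\xi_2)$ is characteristic for double averages: for all $f_1,f_2\in L^\infty(\mu)$, $\frac{1}{N}\sum_{n=1}^N (f_1\circ T_1^n)(f_2\circ T_2^n) - \frac{1}{N}\sum_{n=1}^N (\mathsf{E}_\mu(f_1|\xi_1)\circ T_1^n)(\mathsf{E}_\mu(f_2|\xi_2)\circ T_2^n) \to 0$ in $L^2(\mu)$ as $N\to\infty$. -/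

import Mathlib

open MeasureTheory

/-- The σ-algebra of sets invariant (modulo `μ`-null sets) under `T`. -/
noncomputable def invSigma {X : Type*} [MeasurableSpace X] (μ : Measure X) (T : X → X) :
    MeasurableSpace X where
  MeasurableSet' A := MeasurableSet A ∧ μ (symmDiff A (T ⁻¹' A)) = 0
  measurableSet_empty := ⟨MeasurableSet.empty, by simp⟩
  measurableSet_compl A hA := ⟨hA.1.compl, by
    rw [Set.preimage_compl, compl_symmDiff_compl]; exact hA.2⟩
  measurableSet_iUnion f hf := ⟨MeasurableSet.iUnion fun i => (hf i).1, by
    have hsub : symmDiff (⋃ i, f i) (T ⁻¹' ⋃ i, f i) ⊆ ⋃ i, symmDiff (f i) (T ⁻¹' f i) := by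
      rw [Set.preimage_iUnion]
      intro x hx
      rcases Set.mem_symmDiff.1 hx with ⟨hx1, hx2⟩ | ⟨hx1, hx2⟩
      · rcases Set.mem_iUnion.1 hx1 with ⟨i, hi⟩
        exact Set.mem_iUnion.2 ⟨i, Set.mem_symmDiff.2
          (Or.inl ⟨hi, fun h => hx2 (Set.mem_iUnion.2 ⟨i, h⟩)⟩)⟩
      · rcases Set.mem_iUnion.1 hx1 with ⟨i, hi⟩
        exact Set.mem_iUnion.2 ⟨i, Set.mem_symmDiff.2
          (Or.inr ⟨hi, fun h => hx2 (Set.mem_iUnion.2 ⟨i, h⟩)⟩)⟩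
    exact measure_mono_null hsub (measure_iUnion_null fun i => (hf i).2)⟩

open Filter

theorem dbl_shift_bound {E : Type*} [NormedAddCommGroup E] (u : ℕ → E) (C : ℝ)
    (hu : ∀ n, ‖u n‖ ≤ C) (N h : ℕ) :
    ‖∑ n ∈ Finset.range N, u n - ∑ n ∈ Finset.range N, u (n + h)‖ ≤ 2 * h * C := by
  induction h with
  | zero => simp
  | succ h ih =>
    have e : ∑ n ∈ Finset.range N, u (n + h) - ∑ n ∈ Finset.range N, u (n + (h+1))
        = u h - u (N + h) := by
      have := Finset.sum_range_succ' (fun n => u (n + h)) N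
      rw [Finset.sum_range_succ] at this
      have e2 : ∑ n ∈ Finset.range N, u (n + (h+1)) = ∑ n ∈ Finset.range N, u (n + 1 + h) :=
        Finset.sum_congr rfl fun n _ => by congr 1; ring
      rw [e2]
      simp only [zero_add] at this
      rw [sub_eq_sub_iff_add_eq_add, this]; abel
    calc _ = ‖(∑ n ∈ Finset.range N, u n - ∑ n ∈ Finset.range N, u (n + h)) +
            (u h - u (N + h))‖ := by rw [← e]; congr 1; abel
      _ ≤ 2 * h * C + (C + C) := (norm_add_le _ _).trans
          (add_le_add ih ((norm_sub_le _ _).trans (add_le_add (hu _) (hu _))))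
      _ = _ := by push_cast; ring

theorem dbl_jensen {E : Type*} [NormedAddCommGroup E] (v : ℕ → E) (N : ℕ) :
    ‖∑ n ∈ Finset.range N, v n‖ ^ 2 ≤ N * ∑ n ∈ Finset.range N, ‖v n‖ ^ 2 := by
  calc _ ≤ (∑ n ∈ Finset.range N, ‖v n‖) ^ 2 := by gcongr; exact norm_sum_le _ _
    _ ≤ _ := by simpa using sq_sum_le_card_mul_sum_sq (s := Finset.range N) (f := fun n => ‖v n‖)

theorem dbl_vdc {E : Type*} [NormedAddCommGroup E] [InnerProductSpace ℝ E] (u : ℕ → E) (C : ℝ)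
    (hu : ∀ n, ‖u n‖ ≤ C) (γ : ℕ → ℕ → ℝ)
    (hγ : ∀ h k, Tendsto (fun N : ℕ => (N : ℝ)⁻¹ * ∑ n ∈ Finset.range N,
      inner ℝ (u (n + h)) (u (n + k))) atTop (nhds (γ h k)))
    (hγ0 : Tendsto (fun H : ℕ => ((H : ℝ)⁻¹) ^ 2 * ∑ h ∈ Finset.range H, ∑ k ∈ Finset.range H,
      γ h k) atTop (nhds 0)) :
    Tendsto (fun N : ℕ => (N : ℝ)⁻¹ • ∑ n ∈ Finset.range N, u n) atTop (nhds 0) := by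
  have hC : 0 ≤ C := (norm_nonneg _).trans (hu 0)
  -- the main inequality
  have key : ∀ H N : ℕ, 0 < H → 0 < N →
      ‖(N : ℝ)⁻¹ • ∑ n ∈ Finset.range N, u n‖ ^ 2 ≤
        2 * ((N : ℝ)⁻¹ * (2 * H * C)) ^ 2 + 2 * (((H : ℝ)⁻¹) ^ 2 * ∑ h ∈ Finset.range H,
          ∑ k ∈ Finset.range H, (N : ℝ)⁻¹ * ∑ n ∈ Finset.range N,
            inner ℝ (u (n + h)) (u (n + k))) := by
    intro H N hH hN
    have hH' : (0 : ℝ) < H := by exact_mod_cast hH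
    have hN' : (0 : ℝ) < N := by exact_mod_cast hN
    set v : ℕ → E := fun n => ∑ h ∈ Finset.range H, u (n + h) with hv
    set A := ∑ n ∈ Finset.range N, u n with hA
    set B := (H : ℝ)⁻¹ • ∑ n ∈ Finset.range N, v n with hB
    have h1 : ‖A - B‖ ≤ 2 * H * C := by
      have : A - B = (H : ℝ)⁻¹ • ∑ h ∈ Finset.range H, (A - ∑ n ∈ Finset.range N, u (n + h)) := by
        rw [Finset.sum_sub_distrib, smul_sub, hB]
        congr 1
        · rw [Finset.sum_const, Finset.card_range, ← Nat.cast_smul_eq_nsmul ℝ, smul_smul,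
            inv_mul_cancel₀ hH'.ne', one_smul]
        · congr 1
          rw [hv, Finset.sum_comm]
      rw [this, norm_smul, Real.norm_of_nonneg (by positivity)]
      rw [inv_mul_le_iff₀ hH']
      calc _ ≤ ∑ h ∈ Finset.range H, ‖A - ∑ n ∈ Finset.range N, u (n + h)‖ := norm_sum_le _ _
        _ ≤ ∑ h ∈ Finset.range H, 2 * (H : ℝ) * C := by
            refine Finset.sum_le_sum fun h hh => (dbl_shift_bound u C hu N h).trans ?_
            have : (h : ℝ) ≤ H := by exact_mod_cast (Finset.mem_range.1 hh).le
            gcongr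
        _ = _ := by simp
    have h2 : ‖B‖ ^ 2 ≤ ((H : ℝ)⁻¹) ^ 2 * (N * ∑ n ∈ Finset.range N, ‖v n‖ ^ 2) := by
      rw [hB, norm_smul, mul_pow, Real.norm_of_nonneg (by positivity)]
      gcongr
      exact dbl_jensen v N
    have h3 : ∑ n ∈ Finset.range N, ‖v n‖ ^ 2 = ∑ h ∈ Finset.range H,
          ∑ k ∈ Finset.range H, ∑ n ∈ Finset.range N,
            inner ℝ (u (n + h)) (u (n + k)) := by
      have : ∀ n, ‖v n‖ ^ 2 = ∑ h ∈ Finset.range H,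
          ∑ k ∈ Finset.range H, inner ℝ (u (n + h)) (u (n + k)) := by
        intro n
        rw [← real_inner_self_eq_norm_sq, hv, sum_inner]
        simp_rw [inner_sum]
      simp_rw [this]
      rw [Finset.sum_comm]
      refine Finset.sum_congr rfl fun h _ => ?_
      rw [Finset.sum_comm]
    have h4 : ‖A‖ ^ 2 ≤ 2 * ‖A - B‖ ^ 2 + 2 * ‖B‖ ^ 2 := by
      have : ‖A‖ ≤ ‖A - B‖ + ‖B‖ := by simpa using norm_add_le (A - B) B
      nlinarith [norm_nonneg A, norm_nonneg (A - B), norm_nonneg B, sq_nonneg (‖A - B‖ - ‖B‖)]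
    have h5 : ‖A - B‖ ^ 2 ≤ (2 * H * C) ^ 2 := by gcongr
    simp_rw [← Finset.mul_sum]
    rw [← h3, norm_smul, mul_pow, Real.norm_of_nonneg (by positivity)]
    calc ((N : ℝ)⁻¹) ^ 2 * ‖A‖ ^ 2 ≤ ((N : ℝ)⁻¹) ^ 2 * (2 * (2 * H * C) ^ 2 +
          2 * (((H : ℝ)⁻¹) ^ 2 * (N * ∑ n ∈ Finset.range N, ‖v n‖ ^ 2))) := by
            gcongr; linarith
      _ = _ := by field_simp
  have hlim : ∀ H : ℕ, Tendsto (fun N : ℕ => 2 * ((N : ℝ)⁻¹ * (2 * H * C)) ^ 2 +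
      2 * (((H : ℝ)⁻¹) ^ 2 * ∑ h ∈ Finset.range H,
          ∑ k ∈ Finset.range H, (N : ℝ)⁻¹ * ∑ n ∈ Finset.range N,
            inner ℝ (u (n + h)) (u (n + k)))) atTop (nhds (2 * (0 * (2 * H * C)) ^ 2 +
      2 * (((H : ℝ)⁻¹) ^ 2 * ∑ h ∈ Finset.range H, ∑ k ∈ Finset.range H, γ h k))) := by
    intro H
    refine Tendsto.add ?_ ?_
    · exact (((tendsto_inv_atTop_nhds_zero_nat (𝕜 := ℝ)).mul_const _).pow 2).const_mul _
    · refine Tendsto.const_mul _ (Tendsto.const_mul _ ?_)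
      exact tendsto_finsetSum _ fun h _ => tendsto_finsetSum _ fun k _ => hγ h k
  have hsq : Tendsto (fun N : ℕ => ‖(N : ℝ)⁻¹ • ∑ n ∈ Finset.range N, u n‖ ^ 2) atTop
      (nhds 0) := by
    rw [tendsto_order]
    refine ⟨fun a ha => Eventually.of_forall fun N => lt_of_lt_of_le ha (by positivity), ?_⟩
    intro ε hε
    obtain ⟨H, hH1, hH2⟩ := ((hγ0.eventually (gt_mem_nhds (half_pos hε))).and
      (eventually_gt_atTop 0)).exists
    have := (hlim H).eventually_lt_const (u := ε) (by linarith)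
    filter_upwards [this, eventually_gt_atTop 0] with N h1 h2
    exact (key H N hH2 h2).trans_lt h1
  rw [tendsto_zero_iff_norm_tendsto_zero]
  have := hsq.sqrt
  simpa using this

theorem dbl_ergodic {E : Type*} [NormedAddCommGroup E] [InnerProductSpace ℝ E] [CompleteSpace E]
    (K : E →ₗᵢ[ℝ] E) (w : E) : ∃ φ : E, K φ = φ ∧
      Tendsto (fun N : ℕ => (N : ℝ)⁻¹ • ∑ n ∈ Finset.range N, K^[n] w) atTop (nhds φ) ∧
      ∀ ψ, K ψ = ψ → inner ℝ ψ w = inner ℝ ψ φ := by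
  have h := K.toContinuousLinearMap.tendsto_birkhoffAverage_orthogonalProjection
    K.norm_toContinuousLinearMap_le w
  refine ⟨_, ?_, h, ?_⟩
  · exact (Submodule.coe_mem ((K.toContinuousLinearMap.eqLocus
      (1 : E →L[ℝ] E)).orthogonalProjectionOnto w))
  · intro ψ hψ
    have hm : ψ ∈ K.toContinuousLinearMap.eqLocus (1 : E →L[ℝ] E) := hψ
    have := Submodule.starProjection_inner_eq_zero (𝕜 := ℝ) (K := K.toContinuousLinearMap.eqLocus (1 : E →L[ℝ] E)) w ψ hm
    rw [inner_sub_left, sub_eq_zero] at this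
    rw [real_inner_comm, this, real_inner_comm]
    rfl

theorem dbl_memLp {α : Type*} [MeasurableSpace α] (μ : Measure α) [IsProbabilityMeasure μ]
    {f : α → ℝ} (hf : Measurable f) (hb : ∃ C, ∀ x, |f x| ≤ C) : MemLp f 2 μ := by
  obtain ⟨C, hC⟩ := hb
  exact MemLp.of_bound hf.aestronglyMeasurable C (Eventually.of_forall hC)

theorem dbl_inner {α : Type*} [MeasurableSpace α] (μ : Measure α)
    {f g : α → ℝ} (hf : MemLp f 2 μ) (hg : MemLp g 2 μ) :
    inner ℝ (hf.toLp f) (hg.toLp g) = ∫ x, f x * g x ∂μ := by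
  rw [L2.inner_def]
  refine integral_congr_ae ?_
  filter_upwards [hf.coeFn_toLp, hg.coeFn_toLp] with x h1 h2
  rw [h1, h2]
  simp [mul_comm]

theorem dbl_inv_avg {X : Type*} [m0 : MeasurableSpace X] (μ : Measure X) [IsProbabilityMeasure μ]
    (S : X → X) (hS : MeasurePreserving S μ μ) (g₁ g₂ : X → ℝ)
    (hg₁ : Measurable g₁) (hg₂ : Measurable g₂) (hb₁ : ∃ C, ∀ x, |g₁ x| ≤ C)
    (hb₂ : ∃ C, ∀ x, |g₂ x| ≤ C) :
    Tendsto (fun N : ℕ => (N : ℝ)⁻¹ * ∑ n ∈ Finset.range N, ∫ x, g₁ (S^[n] x) * g₂ x ∂μ) atTop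
      (nhds (∫ x, ((μ[g₁ | invSigma μ S]) x) * ((μ[g₂ | invSigma μ S]) x) ∂μ)) := by
  have hI : invSigma μ S ≤ m0 := fun s hs => hs.1
  have m1 := dbl_memLp μ hg₁ hb₁
  have m2 := dbl_memLp μ hg₂ hb₂
  obtain ⟨φ, hφ, hlim, horth⟩ := dbl_ergodic (Lp.compMeasurePreservingₗᵢ ℝ S hS) (m1.toLp g₁)
  have hφS : φ ∘ S =ᵐ[μ] φ := by
    have := Lp.coeFn_compMeasurePreserving φ hS
    have e : Lp.compMeasurePreserving S hS φ = φ := hφ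
    rw [e] at this
    exact this.symm
  have hφm : Measurable φ := (Lp.stronglyMeasurable φ).measurable
  have hφI : Measurable[invSigma μ S] φ := by
    intro B hB
    refine ⟨hφm hB, ?_⟩
    rw [measure_symmDiff_eq_zero_iff]
    filter_upwards [hφS] with x hx
    have hx' : φ (S x) = φ x := hx
    exact propext (show φ x ∈ B ↔ φ (S x) ∈ B by rw [hx'])
  have hφint : Integrable φ μ := (Lp.memLp φ).integrable (by norm_num)
  have i1 : Integrable g₁ μ := m1.integrable (by norm_num)
  have i2 : Integrable g₂ μ := m2.integrable (by norm_num)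
  have hce : φ =ᵐ[μ] μ[g₁ | invSigma μ S] := by
    refine ae_eq_condExp_of_forall_setIntegral_eq hI i1
      (fun s _ _ => hφint.integrableOn) ?_ hφI.stronglyMeasurable.aestronglyMeasurable
    intro s hs _
    have hs0 : MeasurableSet s := hs.1
    have h := horth (indicatorConstLp 2 hs0 (measure_ne_top μ s) (1 : ℝ)) (by
      change Lp.compMeasurePreserving S hS _ = _
      rw [Lp.indicatorConstLp_compMeasurePreserving]
      have : S ⁻¹' s =ᵐ[μ] s := ((measure_symmDiff_eq_zero_iff).1 hs.2).symm
      refine Lp.ext ?_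
      refine indicatorConstLp_coeFn.trans (EventuallyEq.trans ?_ indicatorConstLp_coeFn.symm)
      exact indicator_ae_eq_of_ae_eq_set this)
    rw [L2.inner_indicatorConstLp_one, L2.inner_indicatorConstLp_one] at h
    rw [← h]
    exact setIntegral_congr_ae hs0 (m1.coeFn_toLp.mono fun x hx _ => hx)
  have hint : ∫ x, ((μ[g₁ | invSigma μ S]) x) * ((μ[g₂ | invSigma μ S]) x) ∂μ
      = inner ℝ φ (m2.toLp g₂) := by
    have i12 : Integrable ((φ : X → ℝ) * g₂) μ := (Lp.memLp φ).integrable_mul m2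
    have h1 := condExp_mul_of_stronglyMeasurable_left (m := invSigma μ S) (μ := μ)
      hφI.stronglyMeasurable i12 i2
    have h2 : inner ℝ φ (m2.toLp g₂) = ∫ x, ((φ : X → ℝ) * g₂) x ∂μ := by
      have := dbl_inner μ (Lp.memLp φ) m2
      rw [Lp.toLp_coeFn] at this
      exact this
    rw [h2, ← integral_condExp hI (f := (φ : X → ℝ) * g₂)]
    refine integral_congr_ae ?_
    filter_upwards [h1, hce] with x a b
    rw [a, ← b]; rfl
  rw [hint]
  have h3 := hlim.inner (tendsto_const_nhds (x := m2.toLp g₂)) (𝕜 := ℝ)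
  refine h3.congr fun N => ?_
  rw [real_inner_smul_left, sum_inner]
  congr 1
  refine Finset.sum_congr rfl fun n _ => ?_
  have e : (Lp.compMeasurePreservingₗᵢ ℝ S hS)^[n] (m1.toLp g₁) =
      (m1.comp_measurePreserving (hS.iterate n)).toLp _ := by
    have := congrFun (Lp.compMeasurePreserving_iterate (E := ℝ) (p := 2) hS n) (m1.toLp g₁)
    rw [Lp.toLp_compMeasurePreserving] at this
    exact this
  rw [e, dbl_inner]
  rfl

theorem dbl_comp {X Y : Type*} [MeasurableSpace X] [MeasurableSpace Y] {μ : Measure X}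
    {ν : Measure Y} {T : X → Y}
    (hT : MeasurePreserving T μ ν) {f : Y → ℝ} (hf : Measurable f) :
    ∫ x, f (T x) ∂μ = ∫ x, f x ∂ν := by
  rw [← hT.map_eq, integral_map hT.measurable.aemeasurable hf.aestronglyMeasurable]

theorem dbl_corr {X : Type*} [MeasurableSpace X] (μ : Measure X)
    (T₁ T₂ T₂inv : X → X)
    (hT1 : MeasurePreserving T₁ μ μ) (hT2 : MeasurePreserving T₂ μ μ)
    (hli : Function.LeftInverse T₂inv T₂) (hri : Function.RightInverse T₂inv T₂)
    (hT2inv : MeasurePreserving T₂inv μ μ)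
    (hcomm : T₁ ∘ T₂ = T₂ ∘ T₁) (g₁ g₂ : X → ℝ)
    (hg₁ : Measurable g₁) (hg₂ : Measurable g₂) (n : ℕ) :
    ∫ x, g₁ (T₁^[n] x) * g₂ (T₂^[n] x) ∂μ = ∫ x, g₁ ((T₁ ∘ T₂inv)^[n] x) * g₂ x ∂μ := by
  have h1 : (T₁ ∘ T₂inv) ∘ T₂ = T₁ := by ext x; simp [hli x]
  have hc : Function.Commute (T₁ ∘ T₂inv) T₂ := by
    intro x
    have := congrFun hcomm (T₂inv x)
    simp only [Function.comp_apply, hri x, hli x] at this ⊢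
    exact this
  have h2 : T₁^[n] = (T₁ ∘ T₂inv)^[n] ∘ T₂^[n] := by
    rw [← hc.comp_iterate, h1]
  have hS := (hT1.comp hT2inv).iterate n
  rw [← dbl_comp (hT2.iterate n) (f := fun x => g₁ ((T₁ ∘ T₂inv)^[n] x) * g₂ x)
    ((hg₁.comp hS.measurable).mul hg₂)]
  rw [h2]
  rfl

theorem dbl_muF_inv {X : Type*} [m0 : MeasurableSpace X]
    (μ : Measure X) [IsProbabilityMeasure μ]
    (T₁ T₂ T₂inv : X → X)
    (hT1 : MeasurePreserving T₁ μ μ) (hT2 : MeasurePreserving T₂ μ μ)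
    (hli : Function.LeftInverse T₂inv T₂) (hri : Function.RightInverse T₂inv T₂)
    (hT2inv : MeasurePreserving T₂inv μ μ)
    (hcomm : T₁ ∘ T₂ = T₂ ∘ T₁)
    (μF : Measure (X × X)) [IsProbabilityMeasure μF]
    (hμF : ∀ f₁ f₂ : X → ℝ, Measurable f₁ → Measurable f₂ →
        (∃ C, ∀ x, |f₁ x| ≤ C) → (∃ C, ∀ x, |f₂ x| ≤ C) →
        ∫ p, f₁ p.1 * f₂ p.2 ∂μF =
          ∫ x, ((μ[f₁ | invSigma μ (T₁ ∘ T₂inv)]) x) *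
              ((μ[f₂ | invSigma μ (T₁ ∘ T₂inv)]) x) ∂μ)
    (g₁ g₂ : X → ℝ)
    (hg₁ : Measurable g₁) (hg₂ : Measurable g₂) (hb₁ : ∃ C, ∀ x, |g₁ x| ≤ C)
    (hb₂ : ∃ C, ∀ x, |g₂ x| ≤ C) :
    ∫ p, g₁ (T₁ p.1) * g₂ (T₂ p.2) ∂μF = ∫ p, g₁ p.1 * g₂ p.2 ∂μF := by
  have hS := hT1.comp hT2inv
  have hb₁' : ∃ C, ∀ x, |g₁ (T₁ x)| ≤ C := hb₁.imp fun C h x => h _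
  have hb₂' : ∃ C, ∀ x, |g₂ (T₂ x)| ≤ C := hb₂.imp fun C h x => h _
  have l1 := dbl_inv_avg μ (T₁ ∘ T₂inv) hS g₁ g₂ hg₁ hg₂ hb₁ hb₂
  have l2 := dbl_inv_avg μ (T₁ ∘ T₂inv) hS (g₁ ∘ T₁) (g₂ ∘ T₂) (hg₁.comp hT1.measurable)
    (hg₂.comp hT2.measurable) hb₁' hb₂'
  rw [← hμF _ _ hg₁ hg₂ hb₁ hb₂] at l1
  rw [← hμF _ _ (hg₁.comp hT1.measurable) (hg₂.comp hT2.measurable) hb₁' hb₂'] at l2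
  set a : ℕ → ℝ := fun n => ∫ x, g₁ ((T₁ ∘ T₂inv)^[n] x) * g₂ x ∂μ with ha
  have e : ∀ n, ∫ x, (g₁ ∘ T₁) ((T₁ ∘ T₂inv)^[n] x) * (g₂ ∘ T₂) x ∂μ = a (n + 1) := by
    intro n
    rw [ha]
    simp only
    rw [← dbl_comp hT2 (f := fun x => g₁ ((T₁ ∘ T₂inv)^[n + 1] x) * g₂ x)
      ((hg₁.comp (hS.iterate (n + 1)).measurable).mul hg₂)]
    refine integral_congr_ae (Eventually.of_forall fun x => ?_)
    simp only [Function.comp_apply]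
    congr 2
    have hc : Function.Commute T₁ (T₁ ∘ T₂inv) := by
      intro x
      have := congrFun hcomm (T₂inv x)
      simp only [Function.comp_apply, hri x] at this ⊢
      rw [this, hli]
    have := (hc.iterate_right n) x
    rw [this, Function.iterate_succ]
    simp [hli x]
  simp_rw [e] at l2
  obtain ⟨C₁, hC₁⟩ := hb₁
  obtain ⟨C₂, hC₂⟩ := hb₂
  have hbd : ∀ n, ‖a n‖ ≤ C₁ * C₂ := by
    intro n
    have := norm_integral_le_of_norm_le_const (μ := μ)
      (f := fun x => g₁ ((T₁ ∘ T₂inv)^[n] x) * g₂ x) (C := C₁ * C₂)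
      (Eventually.of_forall fun x => by
        rw [norm_mul]
        exact mul_le_mul (hC₁ _) (hC₂ _) (norm_nonneg _) ((abs_nonneg _).trans (hC₁ x)))
    simpa using this
  have l3 : Tendsto (fun N : ℕ => (N : ℝ)⁻¹ * ∑ n ∈ Finset.range N, a n -
      (N : ℝ)⁻¹ * ∑ n ∈ Finset.range N, a (n + 1)) atTop (nhds 0) := by
    refine squeeze_zero_norm (a := fun N : ℕ => (N : ℝ)⁻¹ * (2 * (1 : ℕ) * (C₁ * C₂))) ?_ ?_
    · intro N
      rw [← mul_sub, norm_mul, Real.norm_of_nonneg (by positivity)]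
      gcongr
      exact dbl_shift_bound a _ hbd N 1
    · simpa using (tendsto_inv_atTop_nhds_zero_nat (𝕜 := ℝ)).mul_const (2 * (1 : ℕ) * (C₁ * C₂))
  have := tendsto_nhds_unique (l1.sub l2) l3
  rw [sub_eq_zero] at this
  exact this.symm

theorem dbl_muF_mp {X : Type*} [m0 : MeasurableSpace X]
    (μF : Measure (X × X)) [IsProbabilityMeasure μF] (T₁ T₂ : X → X)
    (hT1 : Measurable T₁) (hT2 : Measurable T₂)
    (h : ∀ g₁ g₂ : X → ℝ, Measurable g₁ → Measurable g₂ → (∃ C, ∀ x, |g₁ x| ≤ C) →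
      (∃ C, ∀ x, |g₂ x| ≤ C) →
      ∫ p, g₁ (T₁ p.1) * g₂ (T₂ p.2) ∂μF = ∫ p, g₁ p.1 * g₂ p.2 ∂μF) :
    MeasurePreserving (Prod.map T₁ T₂) μF μF := by
  have hm : Measurable (Prod.map T₁ T₂) := hT1.prodMap hT2
  refine ⟨hm, ?_⟩
  have : IsProbabilityMeasure (μF.map (Prod.map T₁ T₂)) :=
    Measure.isProbabilityMeasure_map hm.aemeasurable
  refine ext_of_generate_finite _ generateFrom_prod.symm isPiSystem_prod ?_ (by simp)
  rintro _ ⟨A, hA, B, hB, rfl⟩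
  have hA : MeasurableSet A := hA
  have hB : MeasurableSet B := hB
  have hbd : ∀ A : Set X, ∃ C : ℝ, ∀ x, |A.indicator (1 : X → ℝ) x| ≤ C := fun A => ⟨1, fun x => by
    by_cases hx : x ∈ A <;> simp [hx]⟩
  have h1 := h (A.indicator 1) (B.indicator 1) (measurable_one.indicator hA)
    (measurable_one.indicator hB) (hbd A) (hbd B)
  have e1 : ∀ p : X × X, A.indicator (1 : X → ℝ) p.1 * B.indicator (1 : X → ℝ) p.2 =
      (A ×ˢ B).indicator (1 : X × X → ℝ) p := by
    intro p
    by_cases ha : p.1 ∈ A <;> by_cases hb : p.2 ∈ B <;> simp [Set.indicator, ha, hb]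
  have e2 : ∀ p : X × X, A.indicator (1 : X → ℝ) (T₁ p.1) * B.indicator (1 : X → ℝ) (T₂ p.2) =
      (Prod.map T₁ T₂ ⁻¹' (A ×ˢ B)).indicator (1 : X × X → ℝ) p := by
    intro p
    exact e1 (Prod.map T₁ T₂ p)
  simp_rw [e1, e2] at h1
  rw [integral_indicator_one (hA.prod hB), integral_indicator_one (hm (hA.prod hB))] at h1
  rw [Measure.map_apply hm (hA.prod hB)]
  exact (measureReal_eq_measureReal_iff).1 h1

theorem dbl_setIntegral_zero {X : Type*} (ξ₁ ξ₂ : MeasurableSpace X) [m0 : MeasurableSpace X]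
    (hξ1 : ξ₁ ≤ m0) (hξ2 : ξ₂ ≤ m0)
    (μF : Measure (X × X)) (F : X × X → ℝ) (hF : Integrable F μF)
    (hz : ∀ A B, MeasurableSet[ξ₁] A → MeasurableSet[ξ₂] B → ∫ p in A ×ˢ B, F p ∂μF = 0)
    (s : Set (X × X)) (hs : MeasurableSet[ξ₁.prod ξ₂] s) : ∫ p in s, F p ∂μF = 0 := by
  have hle : ξ₁.prod ξ₂ ≤ m0.prod m0 :=
    sup_le_sup (MeasurableSpace.comap_mono hξ1) (MeasurableSpace.comap_mono hξ2)
  have huniv : ∫ p, F p ∂μF = 0 := by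
    have := hz Set.univ Set.univ (@MeasurableSet.univ _ ξ₁) (@MeasurableSet.univ _ ξ₂)
    simpa using this
  refine MeasurableSpace.induction_on_inter (m := ξ₁.prod ξ₂)
    (C := fun s _ => ∫ p in s, F p ∂μF = 0)
    (@generateFrom_prod X X ξ₁ ξ₂).symm (@isPiSystem_prod X X ξ₁ ξ₂) ?_ ?_ ?_ ?_ s hs
  · simp
  · rintro _ ⟨A, hA, B, hB, rfl⟩
    exact hz A B hA hB
  · intro t ht h
    have := integral_add_compl (hle _ ht) hF
    rw [h, huniv, zero_add] at this
    exact this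
  · intro f hd hm h
    rw [integral_iUnion (fun i => hle _ (hm i)) hd hF.integrableOn]
    simp [h]

theorem dbl_key {X : Type*} (ξ₁ ξ₂ : MeasurableSpace X) [m0 : MeasurableSpace X]
    (μ : Measure X) [IsProbabilityMeasure μ]
    (T₁ T₂ T₂inv : X → X)
    (hT1 : MeasurePreserving T₁ μ μ) (hT2 : MeasurePreserving T₂ μ μ)
    (hli : Function.LeftInverse T₂inv T₂) (hri : Function.RightInverse T₂inv T₂)
    (hT2inv : MeasurePreserving T₂inv μ μ)
    (hcomm : T₁ ∘ T₂ = T₂ ∘ T₁)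
    (hξ1 : ξ₁ ≤ m0) (hξ2 : ξ₂ ≤ m0)
    (μF : Measure (X × X)) [IsProbabilityMeasure μF]
    (hμF : ∀ f₁ f₂ : X → ℝ, Measurable f₁ → Measurable f₂ →
        (∃ C, ∀ x, |f₁ x| ≤ C) → (∃ C, ∀ x, |f₂ x| ≤ C) →
        ∫ p, f₁ p.1 * f₂ p.2 ∂μF =
          ∫ x, ((μ[f₁ | invSigma μ (T₁ ∘ T₂inv)]) x) *
              ((μ[f₂ | invSigma μ (T₁ ∘ T₂inv)]) x) ∂μ)
    (hchar : ∀ F : X × X → ℝ, Measurable F →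
        (∀ᵐ p ∂μF, F (T₁ p.1, T₂ p.2) = F p) →
        ∃ F' : X × X → ℝ, Measurable[ξ₁.prod ξ₂] F' ∧ F =ᵐ[μF] F')
    (f₁ f₂ : X → ℝ) (hf₁ : Measurable f₁) (hf₂ : Measurable f₂)
    (hb₁ : ∃ C, ∀ x, |f₁ x| ≤ C) (hb₂ : ∃ C, ∀ x, |f₂ x| ≤ C)
    (hz : ∀ A B, MeasurableSet[ξ₁] A → MeasurableSet[ξ₂] B →
      ∫ p, A.indicator f₁ p.1 * B.indicator f₂ p.2 ∂μF = 0) :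
    Tendsto (fun N : ℕ => eLpNorm (fun x =>
          (N : ℝ)⁻¹ * ∑ n ∈ Finset.Icc 1 N, f₁ (T₁^[n] x) * f₂ (T₂^[n] x)) 2 μ)
        atTop (nhds 0) := by
  obtain ⟨C₁, hC₁⟩ := hb₁
  obtain ⟨C₂, hC₂⟩ := hb₂
  have hmul : ∀ a b : ℝ, |a| ≤ C₁ → |b| ≤ C₂ → |a * b| ≤ C₁ * C₂ := by
    intro a b ha hb
    rw [abs_mul]
    exact mul_le_mul ha hb (abs_nonneg _) ((abs_nonneg _).trans ha)
  have hle : ξ₁.prod ξ₂ ≤ m0.prod m0 :=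
    sup_le_sup (MeasurableSpace.comap_mono hξ1) (MeasurableSpace.comap_mono hξ2)
  have hR : MeasurePreserving (Prod.map T₁ T₂) μF μF :=
    dbl_muF_mp μF T₁ T₂ hT1.measurable hT2.measurable
      (dbl_muF_inv μ T₁ T₂ T₂inv hT1 hT2 hli hri hT2inv hcomm μF hμF)
  set F : X × X → ℝ := fun p => f₁ p.1 * f₂ p.2 with hFdef
  have hFm : Measurable F := (hf₁.comp measurable_fst).mul (hf₂.comp measurable_snd)
  have hFb : ∃ C, ∀ p, |F p| ≤ C := ⟨C₁ * C₂, fun p => hmul _ _ (hC₁ _) (hC₂ _)⟩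
  have hFL := dbl_memLp μF hFm hFb
  have hFi : Integrable F μF := hFL.integrable (by norm_num)
  -- conditional expectation of `F` vanishes
  have hset : ∀ s, MeasurableSet[ξ₁.prod ξ₂] s → ∫ p in s, F p ∂μF = 0 := by
    refine dbl_setIntegral_zero ξ₁ ξ₂ hξ1 hξ2 μF F hFi ?_
    intro A B hA hB
    rw [← hz A B hA hB, ← integral_indicator ((hξ1 _ hA).prod (hξ2 _ hB))]
    congr 1
    ext p
    by_cases ha : p.1 ∈ A <;> by_cases hb : p.2 ∈ B <;> simp [Set.indicator, ha, hb, hFdef]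
  have hce : (fun _ => (0 : ℝ)) =ᵐ[μF] μF[F | ξ₁.prod ξ₂] := by
    refine ae_eq_condExp_of_forall_setIntegral_eq hle hFi
      (fun s _ _ => (integrable_zero _ _ _).integrableOn) ?_ aestronglyMeasurable_const
    intro s hs _
    rw [hset s hs]; simp
  set K := Lp.compMeasurePreservingₗᵢ (E := ℝ) (p := 2) ℝ (Prod.map T₁ T₂) hR with hK
  set w := hFL.toLp F with hw
  obtain ⟨φ, hφ, hlim, horth⟩ := dbl_ergodic K (K w)
  have hφm : Measurable φ := (Lp.stronglyMeasurable φ).measurable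
  have hφR : ∀ᵐ p ∂μF, φ (T₁ p.1, T₂ p.2) = φ p := by
    have := Lp.coeFn_compMeasurePreserving φ hR
    have e : Lp.compMeasurePreserving (Prod.map T₁ T₂) hR φ = φ := hφ
    rw [e] at this
    exact this.symm
  obtain ⟨F', hF'm, hF'⟩ := hchar φ hφm hφR
  have hφ0 : φ = 0 := by
    have h1 : inner ℝ φ φ = inner ℝ φ w := by
      rw [← horth φ hφ]
      nth_rw 1 [← hφ]
      exact K.inner_map_map φ w
    have h2 : inner ℝ φ w = ∫ p, ((φ : X × X → ℝ) * F) p ∂μF := by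
      have := dbl_inner μF (Lp.memLp φ) hFL
      rw [Lp.toLp_coeFn] at this
      exact this
    have hae : (φ : X × X → ℝ) * F =ᵐ[μF] F' * F := hF'.mul (EventuallyEq.refl _ _)
    have h3 : Integrable (F' * F) μF := ((Lp.memLp φ).integrable_mul hFL).congr hae
    have h4 := condExp_mul_of_stronglyMeasurable_left (m := ξ₁.prod ξ₂) (μ := μF)
      hF'm.stronglyMeasurable h3 hFi
    rw [h2, integral_congr_ae hae, ← integral_condExp hle (f := F' * F), integral_congr_ae h4,
      integral_eq_zero_of_ae] at h1
    · exact inner_self_eq_zero.1 h1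
    · filter_upwards [hce] with p hp
      simp [← hp]
  rw [hφ0] at hlim
  -- iterates of K
  have hiter : ∀ n, K^[n] (K w) = (hFL.comp_measurePreserving (hR.iterate (n + 1))).toLp _ := by
    intro n
    have := congrFun (Lp.compMeasurePreserving_iterate (E := ℝ) (p := 2) hR (n + 1)) w
    rw [hw, Lp.toLp_compMeasurePreserving, Function.iterate_succ] at this
    exact this
  -- the vectors
  have hum : ∀ n, Measurable (fun x => f₁ (T₁^[n + 1] x) * f₂ (T₂^[n + 1] x)) := fun n =>
    (hf₁.comp (hT1.iterate (n + 1)).measurable).mul (hf₂.comp (hT2.iterate (n + 1)).measurable)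
  have huL : ∀ n, MemLp (fun x => f₁ (T₁^[n + 1] x) * f₂ (T₂^[n + 1] x)) 2 μ := fun n =>
    dbl_memLp μ (hum n) ⟨C₁ * C₂, fun p => hmul _ _ (hC₁ _) (hC₂ _)⟩
  set u : ℕ → Lp ℝ 2 μ := fun n => (huL n).toLp _ with hu
  have hmain : Tendsto (fun N : ℕ => (N : ℝ)⁻¹ • ∑ n ∈ Finset.range N, u n) atTop (nhds 0) := by
    refine dbl_vdc u (C₁ * C₂) ?_ (fun h k => inner ℝ (K^[h] (K w)) (K^[k] (K w))) ?_ ?_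
    · intro n
      have hCC : 0 ≤ C₁ * C₂ := by
        obtain ⟨x⟩ : Nonempty X := μ.nonempty_of_neZero
        exact mul_nonneg ((abs_nonneg _).trans (hC₁ x)) ((abs_nonneg _).trans (hC₂ x))
      have := Lp.norm_le_of_ae_bound (f := u n) hCC (by
        filter_upwards [(huL n).coeFn_toLp] with x hx
        rw [hx]
        exact hmul _ _ (hC₁ _) (hC₂ _))
      simpa [measureUnivNNReal] using this
    · intro h k
      set g₁ : X → ℝ := fun x => f₁ (T₁^[h + 1] x) * f₁ (T₁^[k + 1] x) with hg₁
      set g₂ : X → ℝ := fun x => f₂ (T₂^[h + 1] x) * f₂ (T₂^[k + 1] x) with hg₂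
      have mg₁ : Measurable g₁ := (hf₁.comp (hT1.iterate (h + 1)).measurable).mul
        (hf₁.comp (hT1.iterate (k + 1)).measurable)
      have mg₂ : Measurable g₂ := (hf₂.comp (hT2.iterate (h + 1)).measurable).mul
        (hf₂.comp (hT2.iterate (k + 1)).measurable)
      have bg₁ : ∃ C, ∀ x, |g₁ x| ≤ C := ⟨C₁ * C₁, fun x => by
        rw [hg₁]; simp only [abs_mul]
        exact mul_le_mul (hC₁ _) (hC₁ _) (abs_nonneg _) ((abs_nonneg _).trans (hC₁ x))⟩
      have bg₂ : ∃ C, ∀ x, |g₂ x| ≤ C := ⟨C₂ * C₂, fun x => by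
        rw [hg₂]; simp only [abs_mul]
        exact mul_le_mul (hC₂ _) (hC₂ _) (abs_nonneg _) ((abs_nonneg _).trans (hC₂ x))⟩
      have l := dbl_inv_avg μ (T₁ ∘ T₂inv) (hT1.comp hT2inv) g₁ g₂ mg₁ mg₂ bg₁ bg₂
      rw [← hμF g₁ g₂ mg₁ mg₂ bg₁ bg₂] at l
      have e1 : inner ℝ (K^[h] (K w)) (K^[k] (K w)) = ∫ p, g₁ p.1 * g₂ p.2 ∂μF := by
        rw [hiter, hiter, dbl_inner]
        refine integral_congr_ae (Eventually.of_forall fun p => ?_)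
        simp only [Function.comp_apply, Prod.map_iterate, hFdef, hg₁, hg₂, Prod.map_fst,
          Prod.map_snd]
        ring
      rw [e1]
      refine l.congr fun N => ?_
      congr 1
      refine Finset.sum_congr rfl fun n _ => ?_
      rw [← dbl_corr μ T₁ T₂ T₂inv hT1 hT2 hli hri hT2inv hcomm g₁ g₂ mg₁ mg₂, hu, dbl_inner]
      refine integral_congr_ae (Eventually.of_forall fun x => ?_)
      simp only [hg₁, hg₂, ← Function.iterate_add_apply]
      rw [show n + h + 1 = h + 1 + n by ring, show n + k + 1 = k + 1 + n by ring]
      ring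
    · have h1 := (hlim.norm).pow 2
      simp only [norm_zero, ne_eq, OfNat.ofNat_ne_zero, not_false_eq_true, zero_pow] at h1
      refine h1.congr fun H => ?_
      rw [norm_smul, mul_pow, Real.norm_of_nonneg (by positivity), ← real_inner_self_eq_norm_sq,
        sum_inner]
      simp_rw [inner_sum]
  have h5 := hmain.enorm
  rw [enorm_zero] at h5
  refine h5.congr fun N => ?_
  rw [Lp.enorm_def]
  refine eLpNorm_congr_ae ?_
  have h6 : ∀ᵐ x ∂μ, ∀ n, u n x = f₁ (T₁^[n + 1] x) * f₂ (T₂^[n + 1] x) :=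
    ae_all_iff.2 fun n => (huL n).coeFn_toLp
  filter_upwards [Lp.coeFn_smul (N : ℝ)⁻¹ (∑ n ∈ Finset.range N, u n),
    Lp.coeFn_finsetSum (Finset.range N) u, h6] with x a b c
  rw [a, Pi.smul_apply, b, Finset.sum_apply, smul_eq_mul]
  congr 1
  rw [Finset.sum_congr rfl fun n _ => c n, Finset.range_eq_Ico,
    Finset.sum_Ico_add' (fun n => f₁ (T₁^[n] x) * f₂ (T₂^[n] x)) 0 N 1]
  rfl

theorem dbl_ce_zero {X : Type*} (I ξ : MeasurableSpace X) [m0 : MeasurableSpace X]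
    (μ : Measure X) [IsProbabilityMeasure μ] (hI : I ≤ ξ) (hξ : ξ ≤ m0) (d : X → ℝ)
    (hd : Integrable d μ) (h0 : μ[d | ξ] =ᵐ[μ] 0) (A : Set X) (hA : MeasurableSet[ξ] A) :
    μ[A.indicator d | I] =ᵐ[μ] 0 := by
  have h1 := condExp_condExp_of_le (μ := μ) (f := A.indicator d) hI hξ
  have h2 : μ[A.indicator d | ξ] =ᵐ[μ] 0 := by
    filter_upwards [condExp_indicator hd hA, h0] with x a b
    rw [a]
    by_cases hx : x ∈ A <;> simp [hx, b]
  have h3 := condExp_congr_ae (m := I) h2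
  rw [condExp_zero] at h3
  exact h1.symm.trans h3

theorem dbl_version {X : Type*} (ξ : MeasurableSpace X) [m0 : MeasurableSpace X]
    (μ : Measure X) [IsProbabilityMeasure μ] (hξ : ξ ≤ m0) (f : X → ℝ) (hf : Measurable f)
    (hb : ∃ C, ∀ x, |f x| ≤ C) :
    ∃ e : X → ℝ, Measurable e ∧ (∃ C, ∀ x, |e x| ≤ C) ∧ e =ᵐ[μ] μ[f | ξ] ∧
      μ[f - e | ξ] =ᵐ[μ] 0 := by
  have hfi : Integrable f μ := (dbl_memLp μ hf hb).integrable (by norm_num)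
  obtain ⟨C, hC⟩ := hb
  have hC0 : 0 ≤ C := by
    obtain ⟨x⟩ : Nonempty X := μ.nonempty_of_neZero
    exact (abs_nonneg _).trans (hC x)
  have hm : Measurable (μ[f | ξ]) := (stronglyMeasurable_condExp.mono hξ).measurable
  have hbd := ae_bdd_abs_condExp_of_ae_bdd_abs (m := ξ) (μ := μ) (R := C) (f := f)
    (Eventually.of_forall hC)
  have he : (fun x => max (-C) (min C ((μ[f | ξ]) x))) =ᵐ[μ] μ[f | ξ] := by
    filter_upwards [hbd] with x hx
    have hx' : |(μ[f | ξ]) x| ≤ C := hx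
    rw [abs_le] at hx'
    rw [min_eq_right hx'.2, max_eq_right hx'.1]
  refine ⟨fun x => max (-C) (min C ((μ[f | ξ]) x)), measurable_const.max (measurable_const.min hm),
    ⟨C, fun x => abs_le.2 ⟨le_max_left _ _, max_le (by linarith) (min_le_left _ _)⟩⟩, he, ?_⟩
  have h1 := condExp_sub hfi (integrable_condExp.congr he.symm) ξ
  have h2 := (condExp_congr_ae (m := ξ) he).trans
    (condExp_condExp_of_le (μ := μ) (f := f) le_rfl hξ)
  filter_upwards [h1, h2] with x a b
  rw [a, Pi.sub_apply, b, sub_self]; rfl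

/-- Characteristic factors for double nonconventional averages: if `ξ₁, ξ₂`
contain the σ-algebra `I` of `T₁T₂⁻¹`-invariant sets and every
`(T₁ × T₂)`-invariant function on the Furstenberg self-joining `μᶠ = μ ⊗_I μ`
is `ξ₁ ⊗ ξ₂`-measurable up to null sets, then the pair `(ξ₁, ξ₂)` is
characteristic: the double averages of `f₁, f₂` and of their conditional
expectations are asymptotically equal in `L²(μ)`. -/
theorem characteristic_pair_of_double_averages {X : Type*}
    (ξ₁ ξ₂ : MeasurableSpace X) [m0 : MeasurableSpace X]
    (μ : Measure X) [IsProbabilityMeasure μ]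
    (T₁ T₂ T₂inv : X → X)
    (hT1 : MeasurePreserving T₁ μ μ) (hT2 : MeasurePreserving T₂ μ μ)
    (hT1bij : Function.Bijective T₁)
    (hli : Function.LeftInverse T₂inv T₂) (hri : Function.RightInverse T₂inv T₂)
    (hT2inv : MeasurePreserving T₂inv μ μ)
    (hcomm : T₁ ∘ T₂ = T₂ ∘ T₁)
    (hξ1 : ξ₁ ≤ m0) (hξ2 : ξ₂ ≤ m0)
    (hI1 : invSigma μ (T₁ ∘ T₂inv) ≤ ξ₁) (hI2 : invSigma μ (T₁ ∘ T₂inv) ≤ ξ₂)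
    (μF : Measure (X × X)) [IsProbabilityMeasure μF]
    (hμF : ∀ f₁ f₂ : X → ℝ, Measurable f₁ → Measurable f₂ →
        (∃ C, ∀ x, |f₁ x| ≤ C) → (∃ C, ∀ x, |f₂ x| ≤ C) →
        ∫ p, f₁ p.1 * f₂ p.2 ∂μF =
          ∫ x, ((μ[f₁ | invSigma μ (T₁ ∘ T₂inv)]) x) *
              ((μ[f₂ | invSigma μ (T₁ ∘ T₂inv)]) x) ∂μ)
    (hchar : ∀ F : X × X → ℝ, Measurable F →
        (∀ᵐ p ∂μF, F (T₁ p.1, T₂ p.2) = F p) →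
        ∃ F' : X × X → ℝ, Measurable[ξ₁.prod ξ₂] F' ∧ F =ᵐ[μF] F') :
    ∀ f₁ f₂ : X → ℝ, Measurable f₁ → Measurable f₂ →
      (∃ C, ∀ x, |f₁ x| ≤ C) → (∃ C, ∀ x, |f₂ x| ≤ C) →
      Tendsto (fun N : ℕ => eLpNorm (fun x =>
          (N : ℝ)⁻¹ * ∑ n ∈ Finset.Icc 1 N, f₁ (T₁^[n] x) * f₂ (T₂^[n] x) -
            (N : ℝ)⁻¹ * ∑ n ∈ Finset.Icc 1 N,
              ((μ[f₁ | ξ₁]) (T₁^[n] x) * (μ[f₂ | ξ₂]) (T₂^[n] x))) 2 μ)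
        atTop (nhds 0) := by
  intro f₁ f₂ hf₁ hf₂ hb₁ hb₂
  obtain ⟨e₁, me₁, be₁, ae₁, ze₁⟩ := dbl_version ξ₁ μ hξ1 f₁ hf₁ hb₁
  obtain ⟨e₂, me₂, be₂, ae₂, ze₂⟩ := dbl_version ξ₂ μ hξ2 f₂ hf₂ hb₂
  have hsub : ∀ f e : X → ℝ, (∃ C, ∀ x, |f x| ≤ C) → (∃ C, ∀ x, |e x| ≤ C) →
      ∃ C, ∀ x, |(f - e) x| ≤ C := by
    rintro f e ⟨C, hC⟩ ⟨D, hD⟩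
    exact ⟨C + D, fun x => (abs_sub _ _).trans (add_le_add (hC x) (hD x))⟩
  have hind : ∀ (f : X → ℝ) (A : Set X), (∃ C, ∀ x, |f x| ≤ C) →
      ∃ C, ∀ x, |A.indicator f x| ≤ C := by
    rintro f A ⟨C, hC⟩
    refine ⟨C, fun x => ?_⟩
    by_cases hx : x ∈ A
    · simpa [hx] using hC x
    · simpa [hx] using (abs_nonneg _).trans (hC x)
  have b1 := hsub f₁ e₁ hb₁ be₁
  have b2 := hsub f₂ e₂ hb₂ be₂
  have m1 : Measurable (f₁ - e₁) := hf₁.sub me₁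
  have m2 : Measurable (f₂ - e₂) := hf₂.sub me₂
  have k1 := dbl_key ξ₁ ξ₂ μ T₁ T₂ T₂inv hT1 hT2 hli hri hT2inv hcomm hξ1 hξ2 μF hμF hchar
    (f₁ - e₁) f₂ m1 hf₂ b1 hb₂ (by
      intro A B hA hB
      rw [hμF _ _ (m1.indicator (hξ1 _ hA)) (hf₂.indicator (hξ2 _ hB)) (hind _ _ b1)
        (hind _ _ hb₂)]
      refine integral_eq_zero_of_ae ?_
      filter_upwards [dbl_ce_zero _ ξ₁ μ hI1 hξ1 _
        ((dbl_memLp μ m1 b1).integrable (by norm_num)) ze₁ A hA] with x hx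
      simp [hx])
  have k2 := dbl_key ξ₁ ξ₂ μ T₁ T₂ T₂inv hT1 hT2 hli hri hT2inv hcomm hξ1 hξ2 μF hμF hchar
    e₁ (f₂ - e₂) me₁ m2 be₁ b2 (by
      intro A B hA hB
      rw [hμF _ _ (me₁.indicator (hξ1 _ hA)) (m2.indicator (hξ2 _ hB)) (hind _ _ be₁)
        (hind _ _ b2)]
      refine integral_eq_zero_of_ae ?_
      filter_upwards [dbl_ce_zero _ ξ₂ μ hI2 hξ2 _
        ((dbl_memLp μ m2 b2).integrable (by norm_num)) ze₂ B hB] with x hx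
      simp [hx])
  have k := k1.add k2
  rw [add_zero] at k
  have hms : ∀ (g₁ g₂ : X → ℝ) (N : ℕ), Measurable g₁ → Measurable g₂ →
      Measurable (fun x => (N : ℝ)⁻¹ * ∑ n ∈ Finset.Icc 1 N, g₁ (T₁^[n] x) * g₂ (T₂^[n] x)) := by
    intro g₁ g₂ N h1 h2
    refine measurable_const.mul (Finset.measurable_fun_sum _ fun n _ => ?_)
    exact (h1.comp (hT1.iterate n).measurable).mul (h2.comp (hT2.iterate n).measurable)
  refine tendsto_of_tendsto_of_tendsto_of_le_of_le tendsto_const_nhds k (fun N => zero_le)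
    (fun N => ?_)
  refine le_trans (le_of_eq ?_) (eLpNorm_add_le (hms _ _ N m1 hf₂).aestronglyMeasurable
    (hms _ _ N me₁ m2).aestronglyMeasurable (by norm_num))
  refine eLpNorm_congr_ae ?_
  have q1 : ∀ᵐ x ∂μ, ∀ n, e₁ (T₁^[n] x) = (μ[f₁ | ξ₁]) (T₁^[n] x) :=
    ae_all_iff.2 fun n => (hT1.iterate n).quasiMeasurePreserving.ae ae₁
  have q2 : ∀ᵐ x ∂μ, ∀ n, e₂ (T₂^[n] x) = (μ[f₂ | ξ₂]) (T₂^[n] x) :=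
    ae_all_iff.2 fun n => (hT2.iterate n).quasiMeasurePreserving.ae ae₂
  filter_upwards [q1, q2] with x h1 h2
  rw [Pi.add_apply, ← mul_sub, ← mul_add, ← Finset.sum_sub_distrib, ← Finset.sum_add_distrib]
  congr 1
  refine Finset.sum_congr rfl fun n _ => ?_
  rw [← h1 n, ← h2 n, Pi.sub_apply, Pi.sub_apply]
  ring
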